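/- Let C₁ and C₂ be Cantor sets and let Y = C₁ * C₂ be their topological join. The suspension ΣY is locally connected at each of the two suspension points n and p, and ΣY is not locally connected at any point other than n and p. (A space X is locally connected at a point x if every neighborhood of x contains a connected neighborhood of x.) -/

import Mathlib

open Set Filter Topology

universe u

/-- The equivalence generating the unreduced suspension: collapse `W × {0}` to a point `n`
and `W × {1}` to a point `p`. -/
def suspRel (W : Type u) : W × unitInterval → W × unitInterval → Prop := fun a b =>
  a = b ∨ (a.2 = 0 ∧ b.2 = 0) ∨ (a.2 = 1 ∧ b.2 = 1)

/-- The unreduced suspension `ΣW` of `W`, as a quotient of `W × [0,1]`. -/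
def Susp (W : Type u) : Type u := Quot (suspRel W)

instance (W : Type u) [TopologicalSpace W] : TopologicalSpace (Susp W) :=
  inferInstanceAs (TopologicalSpace (Quot (suspRel W)))

/-- The image of `(w, t)` in the suspension. -/
def suspMk (W : Type u) [TopologicalSpace W] (w : W) (t : unitInterval) : Susp W :=
  Quot.mk _ (w, t)

/-- The set `{n, p}` of the two suspension points of `ΣW` (for `W` nonempty),
i.e. the image of `W × {0, 1}`. -/
def suspPoles (W : Type u) [TopologicalSpace W] : Set (Susp W) :=
  {z | ∃ w t, z = suspMk W w t ∧ (t = 0 ∨ t = 1)}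

/-- The suspension arc of `ΣW` through `w ∈ W`: the image of `{w} × [0,1]`. -/
def suspArc (W : Type u) [TopologicalSpace W] (w : W) : Set (Susp W) :=
  {z | ∃ t, z = suspMk W w t}

/-- The equivalence generating the topological join: identify `(a,b,0) ~ (a,b',0)` and
`(a,b,1) ~ (a',b,1)`. -/
def joinRel (C₁ C₂ : Type u) : C₁ × C₂ × unitInterval → C₁ × C₂ × unitInterval → Prop :=
  fun x y =>
    x = y ∨ (x.2.2 = 0 ∧ y.2.2 = 0 ∧ x.1 = y.1) ∨ (x.2.2 = 1 ∧ y.2.2 = 1 ∧ x.2.1 = y.2.1)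

/-- The topological join `C₁ * C₂`, as a quotient of `C₁ × C₂ × [0,1]`. -/
def TopJoin (C₁ C₂ : Type u) : Type u := Quot (joinRel C₁ C₂)

instance (C₁ C₂ : Type u) [TopologicalSpace C₁] [TopologicalSpace C₂] :
    TopologicalSpace (TopJoin C₁ C₂) :=
  inferInstanceAs (TopologicalSpace (Quot (joinRel C₁ C₂)))

/-- The image of `(a, b, t)` in the join. -/
def joinMk (C₁ C₂ : Type u) [TopologicalSpace C₁] [TopologicalSpace C₂]
    (a : C₁) (b : C₂) (t : unitInterval) : TopJoin C₁ C₂ := Quot.mk _ (a, b, t)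

/-- The copy of `C₁` inside `C₁ * C₂`: the image of `C₁ × C₂ × {0}`. -/
def joinC1 (C₁ C₂ : Type u) [TopologicalSpace C₁] [TopologicalSpace C₂] :
    Set (TopJoin C₁ C₂) := {y | ∃ a b, y = joinMk C₁ C₂ a b 0}

/-- The copy of `C₂` inside `C₁ * C₂`: the image of `C₁ × C₂ × {1}`. -/
def joinC2 (C₁ C₂ : Type u) [TopologicalSpace C₁] [TopologicalSpace C₂] :
    Set (TopJoin C₁ C₂) := {y | ∃ a b, y = joinMk C₁ C₂ a b 1}

/-- The join arc from `a ∈ C₁` to `b ∈ C₂`: the image of `{(a,b)} × [0,1]`. -/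
def joinArc (C₁ C₂ : Type u) [TopologicalSpace C₁] [TopologicalSpace C₂]
    (a : C₁) (b : C₂) : Set (TopJoin C₁ C₂) := {y | ∃ t, y = joinMk C₁ C₂ a b t}

/-- `X` is locally connected at `x`: every neighborhood of `x` contains a connected
neighborhood of `x`. -/
def LocallyConnectedAt {X : Type u} [TopologicalSpace X] (x : X) : Prop :=
  ∀ U ∈ 𝓝 x, ∃ V ∈ 𝓝 x, IsConnected V ∧ V ⊆ U

/-- If `π` is continuous on an open neighborhood of `σ y` and `σ` is a continuous section
of `π`, then local connectedness at `σ y` implies local connectedness at `y`. -/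
theorem LocallyConnectedAt.of_local_retraction {X Y : Type u} [TopologicalSpace X]
    [TopologicalSpace Y] {S : Set X} (hS : IsOpen S) {π : X → Y} (hπ : ContinuousOn π S)
    {σ : Y → X} (hσ : Continuous σ) (hπσ : ∀ y, π (σ y) = y) {y : Y} (hy : σ y ∈ S)
    (h : LocallyConnectedAt (σ y)) : LocallyConnectedAt y := by
  intro U hU
  have hSy : S ∈ 𝓝 (σ y) := hS.mem_nhds hy
  have hpre : π ⁻¹' U ∈ 𝓝 (σ y) :=
    (hπ.continuousAt hSy).preimage_mem_nhds (by rwa [hπσ])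
  obtain ⟨V, hV, hVc, hVU⟩ := h _ (inter_mem hSy hpre)
  refine ⟨π '' V, ?_, hVc.image π (hπ.mono fun x hx => (hVU hx).1), ?_⟩
  · filter_upwards [hσ.continuousAt.preimage_mem_nhds hV] with y' hy'
    exact ⟨σ y', hy', hπσ y'⟩
  · rintro _ ⟨x, hx, rfl⟩
    exact (hVU hx).2

/-- The Cantor space has no isolated points. -/
theorem cantor_singleton_notMem_nhds (x : ℕ → Bool) : ({x} : Set (ℕ → Bool)) ∉ 𝓝 x := by
  intro hx
  have ht : Tendsto (fun n => Function.update x n (!x n)) atTop (𝓝 x) := by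
    refine tendsto_pi_nhds.2 fun i => tendsto_const_nhds.congr' ?_
    filter_upwards [eventually_gt_atTop i] with n hn
    rw [Function.update_of_ne hn.ne]
  obtain ⟨n, hn⟩ := (ht.eventually hx).exists
  have := congrFun (show Function.update x n (!x n) = x from hn) n
  simp at this

/-- A Cantor set is locally connected at none of its points. -/
theorem not_locallyConnectedAt_of_homeomorph_cantor {C : Type u} [TopologicalSpace C]
    (e : C ≃ₜ (ℕ → Bool)) (c : C) : ¬ LocallyConnectedAt c := by
  intro h
  obtain ⟨V, hV, hVc, -⟩ := h univ univ_mem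
  have hsub : (e '' V).Subsingleton :=
    (hVc.isPreconnected.image e e.continuous.continuousOn).subsingleton
  have hmem : e '' V ∈ 𝓝 (e c) := e.isOpenMap.image_mem_nhds hV
  refine cantor_singleton_notMem_nhds (e c) (mem_of_superset hmem fun y hy => ?_)
  exact hsub hy (mem_of_mem_nhds hmem)

section Suspension

variable {W : Type u} [TopologicalSpace W]

theorem isQuotientMap_suspMk :
    IsQuotientMap (fun x : W × unitInterval => suspMk W x.1 x.2) :=
  isQuotientMap_quot_mk

/-- The height of a point of the suspension. -/
def suspHeight (W : Type u) : Susp W → unitInterval :=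
  Quot.lift Prod.snd (by
    rintro a b (rfl | ⟨ha, hb⟩ | ⟨ha, hb⟩)
    · rfl
    · rw [ha, hb]
    · rw [ha, hb])

theorem continuous_suspHeight : Continuous (suspHeight W) :=
  continuous_quot_lift _ continuous_snd

theorem suspMk_eq_of_pole (w w' : W) {t : unitInterval} (ht : t = 0 ∨ t = 1) :
    suspMk W w t = suspMk W w' t :=
  Quot.sound (Or.inr (ht.imp (fun h => ⟨h, h⟩) fun h => ⟨h, h⟩))

open Classical in
/-- The projection of the suspension minus its poles onto the base, extended to the poles by
the constant value `w₀`. -/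
noncomputable def suspProj (w₀ : W) : Susp W → W :=
  Quot.lift (fun x => if x.2 = 0 ∨ x.2 = 1 then w₀ else x.1) (by
    rintro a b (rfl | ⟨ha, hb⟩ | ⟨ha, hb⟩)
    · rfl
    · simp [ha, hb]
    · simp [ha, hb])

theorem suspProj_suspMk (w₀ w : W) {t : unitInterval} (h0 : t ≠ 0) (h1 : t ≠ 1) :
    suspProj w₀ (suspMk W w t) = w :=
  if_neg (not_or.2 ⟨h0, h1⟩)

theorem isOpen_suspHeight_preimage_compl_poles :
    IsOpen (suspHeight W ⁻¹' ({0, 1} : Set unitInterval)ᶜ) :=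
  (((finite_singleton (1 : unitInterval)).insert 0).isClosed.isOpen_compl).preimage
    continuous_suspHeight

theorem continuousOn_suspProj (w₀ : W) :
    ContinuousOn (suspProj w₀) (suspHeight W ⁻¹' ({0, 1} : Set unitInterval)ᶜ) := by
  rw [isQuotientMap_suspMk.continuousOn_isOpen_iff isOpen_suspHeight_preimage_compl_poles]
  refine continuous_fst.continuousOn.congr fun x hx => ?_
  exact if_neg hx

theorem LocallyConnectedAt.of_suspMk {w : W} {t : unitInterval} (h0 : t ≠ 0) (h1 : t ≠ 1)
    (h : LocallyConnectedAt (suspMk W w t)) : LocallyConnectedAt w := by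
  refine LocallyConnectedAt.of_local_retraction (σ := fun w' => suspMk W w' t)
    isOpen_suspHeight_preimage_compl_poles (continuousOn_suspProj w) ?_
    (fun w' => suspProj_suspMk w w' h0 h1) (fun hmem => not_or.2 ⟨h0, h1⟩ hmem) h
  exact isQuotientMap_suspMk.continuous.comp (Continuous.prodMk_left t)

/-- The suspension of a compact space is locally connected at its poles. -/
theorem locallyConnectedAt_suspMk_of_pole [CompactSpace W] (w : W) {t : unitInterval}
    (ht : t = 0 ∨ t = 1) : LocallyConnectedAt (suspMk W w t) := by
  intro U hU
  obtain ⟨O, hOU, hO, hmem⟩ := mem_nhds_iff.1 hU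
  have htube : {s : unitInterval | ∀ w', suspMk W w' s ∈ O} ∈ 𝓝 t := by
    have hc : Continuous fun z : unitInterval × W => suspMk W z.2 z.1 :=
      isQuotientMap_suspMk.continuous.comp continuous_swap
    have hev := isCompact_univ.eventually_forall_of_forall_eventually (x₀ := t) (K := univ)
      (P := fun s w' => suspMk W w' s ∈ O) fun w' _ =>
        hc.continuousAt.preimage_mem_nhds (hO.mem_nhds (by rwa [suspMk_eq_of_pole w' w ht]))
    filter_upwards [hev] with s hs w' using hs w' (mem_univ w')
  have : LocallyConnectedSpace unitInterval :=
    (isQuotientMap_projIcc (h := zero_le_one)).isCoinducing.locallyConnectedSpace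
  obtain ⟨J, hJt, hJc, hJ⟩ := locallyConnectedSpace_iff_connected_subsets.1 this t _ htube
  refine ⟨suspHeight W ⁻¹' J, continuous_suspHeight.continuousAt.preimage_mem_nhds hJt,
    ⟨⟨suspMk W w t, mem_of_mem_nhds (x := t) hJt⟩, ?_⟩, ?_⟩
  · have hcover : suspHeight W ⁻¹' J = ⋃ w', (fun s => suspMk W w' s) '' J := by
      ext z
      obtain ⟨x, rfl⟩ := isQuotientMap_suspMk.surjective z
      refine ⟨fun hx => mem_iUnion.2 ⟨x.1, x.2, hx, rfl⟩, fun hx => ?_⟩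
      obtain ⟨w', s, hs, hsx⟩ := mem_iUnion.1 hx
      rw [← hsx]
      exact hs
    rw [hcover]
    refine isPreconnected_iUnion ⟨suspMk W w t, ?_⟩ fun w' => ?_
    · exact mem_iInter.2 fun w' => ⟨t, mem_of_mem_nhds hJt, suspMk_eq_of_pole w' w ht⟩
    · exact hJc.image _ (isQuotientMap_suspMk.continuous.comp
        (Continuous.prodMk_right w')).continuousOn
  · intro z
    obtain ⟨x, rfl⟩ := isQuotientMap_suspMk.surjective z
    exact fun hx => hOU (hJ hx x.1)

end Suspension

section Join

variable {C₁ C₂ : Type u} [TopologicalSpace C₁] [TopologicalSpace C₂]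

theorem isQuotientMap_joinMk :
    IsQuotientMap (fun x : C₁ × C₂ × unitInterval => joinMk C₁ C₂ x.1 x.2.1 x.2.2) :=
  isQuotientMap_quot_mk

/-- The join parameter of a point of the join. -/
def joinHeight (C₁ C₂ : Type u) : TopJoin C₁ C₂ → unitInterval :=
  Quot.lift (fun x => x.2.2) (by
    rintro a b (rfl | ⟨ha, hb, -⟩ | ⟨ha, hb, -⟩)
    · rfl
    · rw [ha, hb]
    · rw [ha, hb])

theorem continuous_joinHeight : Continuous (joinHeight C₁ C₂) :=
  continuous_quot_lift _ (continuous_snd.comp continuous_snd)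

open Classical in
/-- The projection of the join minus `C₂` onto `C₁`, extended by the constant value `a₀`. -/
noncomputable def joinFst (a₀ : C₁) : TopJoin C₁ C₂ → C₁ :=
  Quot.lift (fun x => if x.2.2 = 1 then a₀ else x.1) (by
    rintro a b (rfl | ⟨ha, hb, h⟩ | ⟨ha, hb, -⟩)
    · rfl
    · simp [ha, hb, h]
    · simp [ha, hb])

open Classical in
/-- The projection of the join minus `C₁` onto `C₂`, extended by the constant value `b₀`. -/
noncomputable def joinSnd (b₀ : C₂) : TopJoin C₁ C₂ → C₂ :=
  Quot.lift (fun x => if x.2.2 = 0 then b₀ else x.2.1) (by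
    rintro a b (rfl | ⟨ha, hb, -⟩ | ⟨ha, hb, h⟩)
    · rfl
    · simp [ha, hb]
    · simp [ha, hb, h])

theorem isOpen_joinHeight_preimage_compl (s : unitInterval) :
    IsOpen (joinHeight C₁ C₂ ⁻¹' ({s} : Set unitInterval)ᶜ) :=
  isOpen_compl_singleton.preimage continuous_joinHeight

theorem continuousOn_joinFst (a₀ : C₁) :
    ContinuousOn (joinFst (C₂ := C₂) a₀) (joinHeight C₁ C₂ ⁻¹' ({1} : Set unitInterval)ᶜ) := by
  rw [isQuotientMap_joinMk.continuousOn_isOpen_iff (isOpen_joinHeight_preimage_compl 1)]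
  exact continuous_fst.continuousOn.congr fun x hx => if_neg hx

theorem continuousOn_joinSnd (b₀ : C₂) :
    ContinuousOn (joinSnd (C₁ := C₁) b₀) (joinHeight C₁ C₂ ⁻¹' ({0} : Set unitInterval)ᶜ) := by
  rw [isQuotientMap_joinMk.continuousOn_isOpen_iff (isOpen_joinHeight_preimage_compl 0)]
  exact (continuous_fst.comp continuous_snd).continuousOn.congr fun x hx => if_neg hx

theorem LocallyConnectedAt.fst_of_joinMk {a : C₁} {b : C₂} {s : unitInterval} (hs : s ≠ 1)
    (h : LocallyConnectedAt (joinMk C₁ C₂ a b s)) : LocallyConnectedAt a := by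
  refine LocallyConnectedAt.of_local_retraction (σ := fun a' => joinMk C₁ C₂ a' b s)
    (isOpen_joinHeight_preimage_compl 1) (continuousOn_joinFst a) ?_ (fun a' => if_neg hs) hs h
  exact isQuotientMap_joinMk.continuous.comp (Continuous.prodMk_left (b, s))

theorem LocallyConnectedAt.snd_of_joinMk {a : C₁} {b : C₂} {s : unitInterval} (hs : s ≠ 0)
    (h : LocallyConnectedAt (joinMk C₁ C₂ a b s)) : LocallyConnectedAt b := by
  refine LocallyConnectedAt.of_local_retraction (σ := fun b' => joinMk C₁ C₂ a b' s)
    (isOpen_joinHeight_preimage_compl 0) (continuousOn_joinSnd b) ?_ (fun b' => if_neg hs) hs h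
  exact isQuotientMap_joinMk.continuous.comp
    (continuous_const.prodMk (Continuous.prodMk_left s))

theorem compactSpace_topJoin [CompactSpace C₁] [CompactSpace C₂] :
    CompactSpace (TopJoin C₁ C₂) :=
  inferInstanceAs (CompactSpace (Quot (joinRel C₁ C₂)))

end Join

/-- The suspension of the join of two Cantor sets is locally connected at each of the two
suspension points, and is not locally connected at any other point. -/
theorem locallyConnected_iff_suspension_point (C₁ C₂ : Type u)
    [TopologicalSpace C₁] [TopologicalSpace C₂]
    (e₁ : C₁ ≃ₜ (ℕ → Bool)) (e₂ : C₂ ≃ₜ (ℕ → Bool)) :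
    (∀ z ∈ suspPoles (TopJoin C₁ C₂), LocallyConnectedAt z) ∧
      (∀ z : Susp (TopJoin C₁ C₂), z ∉ suspPoles (TopJoin C₁ C₂) →
        ¬ LocallyConnectedAt z) := by
  constructor
  · rintro z ⟨w, t, rfl, ht⟩
    have := e₁.symm.compactSpace
    have := e₂.symm.compactSpace
    have : CompactSpace (TopJoin C₁ C₂) := compactSpace_topJoin
    exact locallyConnectedAt_suspMk_of_pole w ht
  · intro z hz h
    obtain ⟨⟨w, t⟩, rfl⟩ := isQuotientMap_suspMk.surjective z
    obtain ⟨⟨a, b, s⟩, rfl⟩ := isQuotientMap_joinMk.surjective w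
    have hj := LocallyConnectedAt.of_suspMk (fun h0 => hz ⟨_, t, rfl, Or.inl h0⟩)
      (fun h1 => hz ⟨_, t, rfl, Or.inr h1⟩) h
    by_cases hs : s = 1
    · exact not_locallyConnectedAt_of_homeomorph_cantor e₂ b
        (hj.snd_of_joinMk (hs ▸ one_ne_zero))
    · exact not_locallyConnectedAt_of_homeomorph_cantor e₁ a (hj.fst_of_joinMk hs)
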